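/- Let n ≥ 2 be an integer, A, G, P∞, M > 0, γ > 1. Let V∞ ∈ C¹([0,M]) with V∞(0) = 0 and (V∞)_x > 0 solve (A (V∞)_x^(−γ))_x = −G x n^((2−2n)/n) V∞^((2−2n)/n) on (0,M) with (V∞)_x(M) = (A/P∞)^(1/γ), and set ρ∞ = (V∞)_x^(−1). Then for every W ∈ C¹([0,M]) with W(0) = 0 and W_x(M) = 0, the second-variation functional satisfies the identity J[W] = I₀[W] + (2n−2) P∞ W(M)²/(n V∞(M)), where J[W] = ∫_0^M [γ A ρ∞^(1+γ) W_x² − (2n−2) G x (nV∞)^((2−3n)/n) W²] dx and I₀[W] = ∫_0^M [γ A ρ∞^(1+γ) W_x² − 2(2n−2) A ρ∞^γ (nV∞)^(−1) W W_x + ((2n−2)/n) A ρ∞^(γ−1) V∞^(−2) W²] dx. Moreover, if γ ≥ (2n−2)/n then I₀[W] ≥ ∫_0^M ((2n−2)/n) A ρ∞^(1+γ) (W_x − W/(ρ∞ V∞))² dx ≥ 0. -/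

import Mathlib

open MeasureTheory intervalIntegral Set

/-- If `f` and `g` vanish at `0` and are differentiable there within `[0, M]`, with `g' 0 ≠ 0`, then
`f / g` extends continuously from `(0, M]` to `[0, M]`. -/
theorem exists_continuousOn_eqOn_div {M a b : ℝ} {f g : ℝ → ℝ}
    (hf : ContinuousOn f (Icc 0 M)) (hg : ContinuousOn g (Icc 0 M))
    (hf' : HasDerivWithinAt f a (Icc 0 M) 0) (hg' : HasDerivWithinAt g b (Icc 0 M) 0)
    (hf0 : f 0 = 0) (hg0 : g 0 = 0) (hb : b ≠ 0) (hgne : ∀ x ∈ Ioc 0 M, g x ≠ 0) :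
    ∃ q : ℝ → ℝ, ContinuousOn q (Icc 0 M) ∧ ∀ x ∈ Ioc 0 M, q x = f x / g x := by
  refine ⟨Function.update (fun x => f x / g x) 0 (a / b), ?_, fun x hx => ?_⟩
  · rw [continuousOn_update_iff]
    have hmem : ∀ x ∈ Icc 0 M \ {0}, x ∈ Ioc 0 M := fun x hx =>
      ⟨lt_of_le_of_ne hx.1.1 (Ne.symm hx.2), hx.1.2⟩
    refine ⟨(hf.mono sdiff_subset).div (hg.mono sdiff_subset) fun x hx => hgne x (hmem x hx),
      fun _ => ?_⟩
    refine ((hasDerivWithinAt_iff_tendsto_slope.1 hf').div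
      (hasDerivWithinAt_iff_tendsto_slope.1 hg') hb).congr' ?_
    filter_upwards [self_mem_nhdsWithin] with x hx
    have hx0 : x ≠ 0 := hx.2
    have hgx := hgne x (hmem x hx)
    simp only [Pi.div_apply, slope_def_field, hf0, hg0, sub_zero]
    field_simp
  · exact Function.update_of_ne hx.1.ne' _ _

theorem pos_of_hasDerivWithinAt_pos {M : ℝ} {f f' : ℝ → ℝ}
    (hf : ∀ x ∈ Icc (0 : ℝ) M, HasDerivWithinAt f (f' x) (Icc 0 M) x)
    (hf' : ∀ x ∈ Icc (0 : ℝ) M, 0 < f' x) (hf0 : f 0 = 0) :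
    ∀ x ∈ Ioc 0 M, 0 < f x := by
  intro x hx
  have hmono : StrictMonoOn f (Icc 0 M) := by
    refine strictMonoOn_of_deriv_pos (convex_Icc 0 M)
      (fun y hy => (hf y hy).continuousWithinAt) fun y hy => ?_
    rw [interior_Icc] at hy
    rw [((hf y (Ioo_subset_Icc_self hy)).hasDerivAt (Icc_mem_nhds hy.1 hy.2)).deriv]
    exact hf' y (Ioo_subset_Icc_self hy)
  simpa [hf0] using hmono ⟨le_rfl, hx.1.le.trans hx.2⟩ ⟨hx.1.le, hx.2⟩ hx.1

theorem intervalIntegrable_of_continuousOn_of_eqOn_Ioc {M : ℝ} (hM : 0 ≤ M) {f g : ℝ → ℝ}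
    (hg : ContinuousOn g (Icc 0 M)) (h : EqOn g f (Ioc 0 M)) :
    IntervalIntegrable f volume 0 M := by
  refine IntervalIntegrable.congr ?_ (hg.intervalIntegrable_of_Icc hM)
  rwa [uIoc_of_le hM]

/-- Second-variation identity: for a solution `V∞` of the stationary boundary-value
problem with `ρ∞ = (V∞)_x⁻¹`, and every `C¹` function `W` with `W(0) = 0`, `W_x(M) = 0`,
`J[W] = I₀[W] + (2n−2) P∞ W(M)²/(n V∞(M))`; moreover if `γ ≥ (2n−2)/n` then
`I₀[W] ≥ ∫_0^M ((2n−2)/n) A ρ∞^(1+γ) (W_x − W/(ρ∞ V∞))² dx ≥ 0`. -/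
theorem second_variation_identity
    (n : ℕ) (hn : 2 ≤ n) (A G Pinf M γ : ℝ)
    (hA : 0 < A) (hG : 0 < G) (hPinf : 0 < Pinf) (hM : 0 < M) (hγ : 1 < γ)
    (V Vd : ℝ → ℝ)
    (hV : ∀ x ∈ Set.Icc (0 : ℝ) M, HasDerivWithinAt V (Vd x) (Set.Icc 0 M) x)
    (hVd : ContinuousOn Vd (Set.Icc (0 : ℝ) M))
    (hV0 : V 0 = 0)
    (hVpos : ∀ x ∈ Set.Icc (0 : ℝ) M, 0 < Vd x)
    (hODE : ∀ x ∈ Set.Ioo (0 : ℝ) M,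
      HasDerivAt (fun y => A * (Vd y) ^ (-γ))
        (-(G * x * (n : ℝ) ^ ((2 - 2 * (n : ℝ)) / (n : ℝ)) *
          (V x) ^ ((2 - 2 * (n : ℝ)) / (n : ℝ)))) x)
    (hVM : Vd M = (A / Pinf) ^ (1 / γ))
    (W Wd : ℝ → ℝ)
    (hW : ∀ x ∈ Set.Icc (0 : ℝ) M, HasDerivWithinAt W (Wd x) (Set.Icc 0 M) x)
    (hWd : ContinuousOn Wd (Set.Icc (0 : ℝ) M))
    (hW0 : W 0 = 0) (hWM : Wd M = 0) :
    (∫ x in (0 : ℝ)..M,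
        (γ * A * ((Vd x)⁻¹) ^ (1 + γ) * (Wd x) ^ 2 -
          (2 * (n : ℝ) - 2) * G * x * ((n : ℝ) * V x) ^ ((2 - 3 * (n : ℝ)) / (n : ℝ)) *
            (W x) ^ 2)) =
      (∫ x in (0 : ℝ)..M,
        (γ * A * ((Vd x)⁻¹) ^ (1 + γ) * (Wd x) ^ 2 -
          2 * (2 * (n : ℝ) - 2) * A * ((Vd x)⁻¹) ^ γ * ((n : ℝ) * V x)⁻¹ * W x * Wd x +
          (2 * (n : ℝ) - 2) / (n : ℝ) * A * ((Vd x)⁻¹) ^ (γ - 1) * (V x ^ 2)⁻¹ *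
            (W x) ^ 2)) +
        (2 * (n : ℝ) - 2) * Pinf * (W M) ^ 2 / ((n : ℝ) * V M) ∧
    ((2 * (n : ℝ) - 2) / (n : ℝ) ≤ γ →
      (∫ x in (0 : ℝ)..M,
          (2 * (n : ℝ) - 2) / (n : ℝ) * A * ((Vd x)⁻¹) ^ (1 + γ) *
            (Wd x - W x / ((Vd x)⁻¹ * V x)) ^ 2) ≤
        (∫ x in (0 : ℝ)..M,
          (γ * A * ((Vd x)⁻¹) ^ (1 + γ) * (Wd x) ^ 2 -
            2 * (2 * (n : ℝ) - 2) * A * ((Vd x)⁻¹) ^ γ * ((n : ℝ) * V x)⁻¹ * W x * Wd x +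
            (2 * (n : ℝ) - 2) / (n : ℝ) * A * ((Vd x)⁻¹) ^ (γ - 1) * (V x ^ 2)⁻¹ *
              (W x) ^ 2)) ∧
      0 ≤ ∫ x in (0 : ℝ)..M,
          (2 * (n : ℝ) - 2) / (n : ℝ) * A * ((Vd x)⁻¹) ^ (1 + γ) *
            (Wd x - W x / ((Vd x)⁻¹ * V x)) ^ 2) := by
  have hn0 : (0 : ℝ) < n := by
    have : 0 < n := by omega
    exact_mod_cast this
  have hn2 : (2 : ℝ) ≤ n := by exact_mod_cast hn
  have hVc : ContinuousOn V (Icc 0 M) := fun x hx => (hV x hx).continuousWithinAt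
  have hWc : ContinuousOn W (Icc 0 M) := fun x hx => (hW x hx).continuousWithinAt
  have h0 : (0 : ℝ) ∈ Icc (0 : ℝ) M := ⟨le_rfl, hM.le⟩
  have hVp := pos_of_hasDerivWithinAt_pos hV hVpos hV0
  have hVM0 : 0 < V M := hVp M ⟨hM, le_rfl⟩
  obtain ⟨w, hwc, hw⟩ := exists_continuousOn_eqOn_div hWc hVc (hW 0 h0) (hV 0 h0) hW0 hV0
    (hVpos 0 h0).ne' fun x hx => (hVp x hx).ne'
  obtain ⟨q, hqc, hq⟩ := exists_continuousOn_eqOn_div continuousOn_id hVc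
    (hasDerivWithinAt_id 0 _) (hV 0 h0) rfl hV0 (hVpos 0 h0).ne' fun x hx => (hVp x hx).ne'
  have hρ : ∀ s : ℝ, ContinuousOn (fun x => ((Vd x)⁻¹) ^ s) (Icc 0 M) := fun s =>
    (hVd.inv₀ fun x hx => (hVpos x hx).ne').rpow_const fun x hx =>
      Or.inl (inv_pos.2 (hVpos x hx)).ne'
  have hVpow : ContinuousOn (fun x => (V x) ^ ((2 : ℝ) / n)) (Icc 0 M) :=
    hVc.rpow_const fun x _ => Or.inr (by positivity)
  have hJ : IntervalIntegrable (fun x => γ * A * ((Vd x)⁻¹) ^ (1 + γ) * (Wd x) ^ 2 -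
      (2 * (n : ℝ) - 2) * G * x * ((n : ℝ) * V x) ^ ((2 - 3 * (n : ℝ)) / (n : ℝ)) *
        (W x) ^ 2) volume 0 M := by
    have hρ' := hρ (1 + γ)
    refine intervalIntegrable_of_continuousOn_of_eqOn_Ioc hM.le
      (g := fun x => γ * A * ((Vd x)⁻¹) ^ (1 + γ) * (Wd x) ^ 2 -
        (2 * (n : ℝ) - 2) * G * (n : ℝ) ^ ((2 - 3 * (n : ℝ)) / (n : ℝ)) *
          (q x * w x ^ 2 * (V x) ^ ((2 : ℝ) / n))) (by fun_prop) fun x hx => ?_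
    have hVx := hVp x hx
    have he : (2 - 3 * (n : ℝ)) / n = 2 / n - (3 : ℕ) := by
      field_simp
      push_cast
      ring
    have hpow : (V x) ^ ((2 - 3 * (n : ℝ)) / n) = (V x) ^ ((2 : ℝ) / n) / (V x) ^ 3 := by
      rw [he, Real.rpow_sub_natCast hVx.ne']
    simp only [hq x hx, hw x hx, id]
    rw [Real.mul_rpow hn0.le hVx.le, hpow]
    field_simp
  have hI : IntervalIntegrable (fun x => γ * A * ((Vd x)⁻¹) ^ (1 + γ) * (Wd x) ^ 2 -
      2 * (2 * (n : ℝ) - 2) * A * ((Vd x)⁻¹) ^ γ * ((n : ℝ) * V x)⁻¹ * W x * Wd x +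
      (2 * (n : ℝ) - 2) / (n : ℝ) * A * ((Vd x)⁻¹) ^ (γ - 1) * (V x ^ 2)⁻¹ *
        (W x) ^ 2) volume 0 M := by
    have hρ1 := hρ (1 + γ)
    have hρ2 := hρ γ
    have hρ3 := hρ (γ - 1)
    refine intervalIntegrable_of_continuousOn_of_eqOn_Ioc hM.le
      (g := fun x => γ * A * ((Vd x)⁻¹) ^ (1 + γ) * (Wd x) ^ 2 -
        2 * (2 * (n : ℝ) - 2) * A * ((Vd x)⁻¹) ^ γ * (n : ℝ)⁻¹ * w x * Wd x +
        (2 * (n : ℝ) - 2) / (n : ℝ) * A * ((Vd x)⁻¹) ^ (γ - 1) * w x ^ 2)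
      (by fun_prop) fun x hx => ?_
    have hVx := hVp x hx
    simp only [hw x hx]
    field_simp
  have hQ : IntervalIntegrable (fun x => (2 * (n : ℝ) - 2) / (n : ℝ) * A *
      ((Vd x)⁻¹) ^ (1 + γ) * (Wd x - W x / ((Vd x)⁻¹ * V x)) ^ 2) volume 0 M := by
    have hρ1 := hρ (1 + γ)
    refine intervalIntegrable_of_continuousOn_of_eqOn_Ioc hM.le
      (g := fun x => (2 * (n : ℝ) - 2) / (n : ℝ) * A *
        ((Vd x)⁻¹) ^ (1 + γ) * (Wd x - w x * Vd x) ^ 2) (by fun_prop) fun x hx => ?_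
    have hVx := hVp x hx
    have hVdx := hVpos x (Ioc_subset_Icc_self hx)
    simp only [hw x hx]
    field_simp
  have hρpow : ∀ x ∈ Icc (0 : ℝ) M, ((Vd x)⁻¹) ^ (1 + γ) = ((Vd x)⁻¹) ^ γ / Vd x ∧
      ((Vd x)⁻¹) ^ (γ - 1) = ((Vd x)⁻¹) ^ γ * Vd x ∧
      (Vd x) ^ (-γ) = ((Vd x)⁻¹) ^ γ := fun x hx => by
    have hVdx := hVpos x hx
    refine ⟨?_, ?_, ?_⟩
    · rw [add_comm, Real.rpow_add_one (inv_pos.2 hVdx).ne', div_eq_mul_inv]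
    · rw [Real.rpow_sub_one (inv_pos.2 hVdx).ne', div_inv_eq_mul]
    · rw [Real.rpow_neg hVdx.le, Real.inv_rpow hVdx.le]
  refine ⟨?_, fun hγn => ⟨?_, ?_⟩⟩
  · have hcont : ContinuousOn (fun x => (2 * (n : ℝ) - 2) / n *
        ((A * (Vd x) ^ (-γ)) * ((W x) ^ 2 / V x))) (Icc 0 M) := by
      have hρ2 := hρ γ
      refine ContinuousOn.congr (f := fun x => (2 * (n : ℝ) - 2) / n *
        ((A * ((Vd x)⁻¹) ^ γ) * (W x * w x))) (by fun_prop) fun x hx => ?_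
      simp only [(hρpow x hx).2.2]
      rcases hx.1.eq_or_lt with h | h
      · simp [← h, hW0]
      · rw [hw x ⟨h, hx.2⟩, sq, mul_div_assoc]
    have hFTC := integral_eq_sub_of_hasDerivAt_of_le hM.le hcont (fun x hx => ?_) (hJ.sub hI)
    · have hb : A * (Vd M) ^ (-γ) = Pinf := by
        rw [hVM, ← Real.rpow_mul (by positivity)]
        have : 1 / γ * -γ = -1 := by field_simp
        rw [this, Real.rpow_neg_one]
        field_simp
      rw [integral_sub hJ hI, hb, hW0] at hFTC
      rw [sub_eq_iff_eq_add.1 hFTC]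
      field_simp
      ring
    · have hxI := Ioo_subset_Icc_self hx
      have hVx := hVp x (Ioo_subset_Ioc_self hx)
      have hVdx := hVpos x hxI
      have hnhds := Icc_mem_nhds hx.1 hx.2
      have hder := ((hODE x hx).mul ((((hW x hxI).hasDerivAt hnhds).pow 2).div
        ((hV x hxI).hasDerivAt hnhds) hVx.ne')).const_mul ((2 * (n : ℝ) - 2) / n)
      refine hder.congr_deriv ?_
      have hpow : ((n : ℝ) * V x) ^ ((2 - 3 * (n : ℝ)) / n) =
          (n : ℝ) ^ ((2 - 2 * (n : ℝ)) / n) * (V x) ^ ((2 - 2 * (n : ℝ)) / n) /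
            (n * V x) := by
        have he : (2 - 3 * (n : ℝ)) / n = (2 - 2 * n) / n - 1 := by
          field_simp
          ring
        rw [he, Real.rpow_sub_one (by positivity), Real.mul_rpow hn0.le hVx.le]
      obtain ⟨h1, h2, h3⟩ := hρpow x hxI
      simp only [Pi.pow_apply, Pi.div_apply]
      rw [hpow, h1, h2, h3]
      field_simp
      ring
  · refine integral_mono_on_of_le_Ioo hM.le hQ hI fun x hx => ?_
    have hxI := Ioo_subset_Icc_self hx
    have hVx := hVp x (Ioo_subset_Ioc_self hx)
    have hVdx := hVpos x hxI
    obtain ⟨h1, h2, -⟩ := hρpow x hxI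
    have hnonneg : 0 ≤ (γ - (2 * (n : ℝ) - 2) / n) *
        (A * (((Vd x)⁻¹) ^ γ / Vd x) * (Wd x) ^ 2) :=
      mul_nonneg (sub_nonneg.2 hγn) (by positivity)
    rw [h1, h2, ← sub_nonneg]
    refine hnonneg.trans_eq ?_
    field_simp
    ring
  · refine integral_nonneg hM.le fun x hx => ?_
    have hVdx := hVpos x hx
    have : 0 ≤ 2 * (n : ℝ) - 2 := by linarith
    positivity
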